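/- Let m ≥ 1 and let n, ℓ be integers with Δ = 4mn − ℓ² > 0. Then the triple series Σ_{γ=1}^∞ Σ_{ℓ̃=−m+1}^{m} Σ_{g ≡ ℓ̃ (mod 2m), −mγ < g ≤ mγ} Kl(Δ/(4m), −1 − g²/(4m); γ, ψ)_{ℓℓ̃}·γ^{−2}·∫_{−1/√m}^{1/√m} f_{γ,g,m}(x)·(1 − mx²)^{25/4}·I_{25/2}(2π√(Δ(1 − mx²))/(γ√m)) dx, multiplied by (2π)^{−1}·d(m)·(4m/Δ)^{25/4}, converges absolutely and the modulus of its sum is at most (1 + 2/21)·d(m)·(4m/Δ)^{25/4}·m^{3/2}·π·(π²/3 + 1/3)·I_{25/2}(2π√(Δ/m)). -/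

import Mathlib

open Real

noncomputable def besselI (ν x : ℝ) : ℝ :=
  ∑' k : ℕ, (x / 2) ^ (2 * (k : ℝ) + ν) / ((k.factorial : ℝ) * Real.Gamma ((k : ℝ) + ν + 1))

/-- The multiplier system `ψ(γ, δ)_{ℓ̃ℓ}` of the index-`m` theta functions, where
`α` is the inverse of `δ` modulo `γ` (taken in `[0, γ)`). -/
noncomputable def psiMult (m γ : ℕ) (δ : ℤ) (ℓt ℓ : ℤ) : ℂ :=
  (((2 * m * γ : ℕ) : ℂ) * Complex.I) ^ (-(1 / 2 : ℂ)) *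
    ∑ T ∈ Finset.range γ,
      Complex.exp (2 * (Real.pi : ℂ) * Complex.I *
        ((((((δ : ZMod γ)⁻¹).val : ℕ) : ℂ) * ((ℓt : ℂ) - 2 * m * T) ^ 2) / (4 * m * γ)
          - ((ℓ : ℂ) * ((ℓt : ℂ) - 2 * m * T)) / (2 * m * γ)
          + ((δ : ℂ) * (ℓ : ℂ) ^ 2) / (4 * m * γ)))

/-- The generalized Kloosterman sum `Kl(A, B; γ, ψ)_{ℓℓ̃}`: the sum runs over
`δ = -j` with `0 ≤ j < γ` and `gcd(j, γ) = 1`, and `α(δ, γ)` is the inverse of `δ` mod `γ`. -/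
noncomputable def Kl (m : ℕ) (A B : ℚ) (γ : ℕ) (ℓ ℓt : ℤ) : ℂ :=
  ∑ j ∈ (Finset.range γ).filter fun j => Nat.gcd j γ = 1,
    Complex.exp (2 * (Real.pi : ℂ) * Complex.I *
      (((((-(j : ℤ) : ZMod γ)⁻¹).val : ℕ) : ℂ) * (B : ℂ) / γ + ((-(j : ℤ) : ℤ) : ℂ) * (A : ℂ) / γ)) *
    psiMult m γ (-(j : ℤ)) ℓt ℓ

/-- `d n`: the coefficient of `q^(n+1)` in `∏ (1 - q^j)^{-24}`. -/
def dcoef (n : ℤ) : ℤ :=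
  if 0 ≤ n + 1 then
    ∑ v ∈ Finset.Nat.antidiagonalTuple 24 (n + 1).toNat,
      ∏ i, (Fintype.card (Nat.Partition (v i)) : ℤ)
  else 0

/-- The function `f_{γ,g,m}(x)`. -/
noncomputable def fFun (m γ : ℕ) (g : ℤ) (x : ℝ) : ℂ :=
  if g % (2 * (m : ℤ) * γ) = 0 then
    ((Real.pi ^ 2 / (Real.sinh (Real.pi * x / γ)) ^ 2 - (γ : ℝ) ^ 2 / x ^ 2 : ℝ) : ℂ)
  else
    (Real.pi : ℂ) ^ 2 /
      (Complex.sinh ((Real.pi : ℂ) * x / γ - (Real.pi : ℂ) * Complex.I * g / (2 * m * γ))) ^ 2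

/-- The inner integral `∫_{-1/√m}^{1/√m} f_{γ,g,m}(x) (1-mx²)^{25/4}
    I_{25/2}(2π√(Δ(1-mx²))/(γ√m)) dx`. -/
noncomputable def innerInt (m γ : ℕ) (g : ℤ) (Δ : ℤ) : ℂ :=
  ∫ x in (-(1 : ℝ) / Real.sqrt m)..(1 / Real.sqrt m),
    fFun m γ g x * (((1 - m * x ^ 2 : ℝ) ^ ((25 : ℝ) / 4) : ℝ) : ℂ) *
      (besselI (25 / 2)
        (2 * Real.pi * Real.sqrt ((Δ : ℝ) * (1 - m * x ^ 2)) / (γ * Real.sqrt m)) : ℝ)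

/-- The inner (finite) double sum over `ℓ̃` and `g` of the triple series,
for a given `γ ≥ 1`. -/
noncomputable def tripleTerm (m : ℕ) (ℓ : ℤ) (Δ : ℤ) (γ : ℕ) : ℂ :=
  ∑ ℓt ∈ Finset.Icc (-(m : ℤ) + 1) (m : ℤ),
    ∑ g ∈ (Finset.Ioc (-(m : ℤ) * γ) ((m : ℤ) * γ)).filter
        (fun g => g % (2 * (m : ℤ)) = ℓt % (2 * (m : ℤ))),
      Kl m ((Δ : ℚ) / (4 * m)) (-1 - (g : ℚ) ^ 2 / (4 * m)) γ ℓ ℓt *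
        ((γ : ℂ) ^ 2)⁻¹ * innerInt m γ g Δ

theorem besselI_term_nonneg {x : ℝ} (hx : 0 ≤ x) (k : ℕ) :
    0 ≤ (x / 2) ^ (2 * (k : ℝ) + 25 / 2) /
      ((k.factorial : ℝ) * Real.Gamma ((k : ℝ) + 25 / 2 + 1)) := by
  have : 0 < Real.Gamma ((k : ℝ) + 25 / 2 + 1) := Real.Gamma_pos_of_pos (by positivity)
  positivity

theorem one_le_Gamma_of_two_le {x : ℝ} (hx : 2 ≤ x) : 1 ≤ Real.Gamma x := by
  have := Real.Gamma_strictMonoOn_Ici.monotoneOn (Set.mem_Ici.2 le_rfl) (Set.mem_Ici.2 hx) hx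
  simpa [Real.Gamma_two] using this

theorem besselI_summable {x : ℝ} (hx : 0 ≤ x) :
    Summable fun k : ℕ => (x / 2) ^ (2 * (k : ℝ) + 25 / 2) /
      ((k.factorial : ℝ) * Real.Gamma ((k : ℝ) + 25 / 2 + 1)) := by
  refine Summable.of_nonneg_of_le (besselI_term_nonneg hx) (fun k => ?_)
    ((Real.summable_pow_div_factorial ((x / 2) ^ 2)).mul_left ((x / 2) ^ (25 / 2 : ℝ)))
  have hG : 1 ≤ Real.Gamma ((k : ℝ) + 25 / 2 + 1) :=
    one_le_Gamma_of_two_le (by linarith [(Nat.cast_nonneg k : (0 : ℝ) ≤ k)])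
  have hp : (x / 2) ^ (2 * (k : ℝ) + 25 / 2) = (x / 2) ^ (25 / 2 : ℝ) * ((x / 2) ^ 2) ^ k := by
    rw [Real.rpow_add_of_nonneg (by positivity) (by positivity) (by norm_num), mul_comm,
      ← pow_mul, ← Real.rpow_natCast]
    push_cast
    rfl
  rw [hp, mul_div_assoc]
  gcongr
  exact le_mul_of_one_le_right (by positivity) hG

theorem besselI_nonneg {x : ℝ} (hx : 0 ≤ x) : 0 ≤ besselI (25 / 2) x :=
  tsum_nonneg (besselI_term_nonneg hx)

theorem besselI_le_of_le_div {x y : ℝ} {N : ℕ} (hN : 1 ≤ N) (hx : 0 ≤ x) (hy : 0 ≤ y)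
    (h : x ≤ y / N) :
    besselI (25 / 2) x ≤ ((N : ℝ) ^ 6)⁻¹ * besselI (25 / 2) y := by
  have hN' : (1 : ℝ) ≤ N := by exact_mod_cast hN
  unfold besselI
  rw [← tsum_mul_left]
  refine Summable.tsum_le_tsum (fun k => ?_) (besselI_summable hx)
    ((besselI_summable hy).mul_left _)
  have hG : 0 < Real.Gamma ((k : ℝ) + 25 / 2 + 1) := Real.Gamma_pos_of_pos (by positivity)
  rw [← mul_div_assoc]
  gcongr
  calc (x / 2) ^ (2 * (k : ℝ) + 25 / 2)
      ≤ ((N : ℝ)⁻¹ * (y / 2)) ^ (2 * (k : ℝ) + 25 / 2) := by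
        apply Real.rpow_le_rpow (by positivity) _ (by positivity)
        calc x / 2 ≤ (y / N) / 2 := by gcongr
          _ = _ := by ring
    _ = (N : ℝ)⁻¹ ^ (2 * (k : ℝ) + 25 / 2) * (y / 2) ^ (2 * (k : ℝ) + 25 / 2) :=
        Real.mul_rpow (by positivity) (by positivity)
    _ ≤ ((N : ℝ) ^ 6)⁻¹ * (y / 2) ^ (2 * (k : ℝ) + 25 / 2) := by
        gcongr
        rw [← inv_pow, ← Real.rpow_natCast (N : ℝ)⁻¹ 6]
        apply Real.rpow_le_rpow_of_exponent_ge (by positivity) (inv_le_one_of_one_le₀ hN')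
        push_cast
        linarith [(Nat.cast_nonneg k : (0 : ℝ) ≤ k)]

theorem norm_psiMult_le {m γ : ℕ} (hm : 1 ≤ m) (hγ : 1 ≤ γ) (δ ℓt ℓ : ℤ) :
    ‖psiMult m γ δ ℓt ℓ‖ ≤ 3 / 4 * γ := by
  have h2 : (2 : ℝ) ≤ ((2 * m * γ : ℕ) : ℝ) := by
    have : 2 ≤ 2 * m * γ := by nlinarith [Nat.mul_le_mul hm hγ]
    exact_mod_cast this
  unfold psiMult
  rw [norm_mul]
  refine mul_le_mul ?_ ?_ (norm_nonneg _) (by norm_num)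
  · have : (-(1 / 2 : ℂ)) = ((-(1 / 2) : ℝ) : ℂ) := by push_cast; ring
    rw [this, Complex.norm_cpow_real, norm_mul, Complex.norm_I, mul_one, Complex.norm_natCast]
    calc ((2 * m * γ : ℕ) : ℝ) ^ (-(1 / 2) : ℝ) ≤ 2 ^ (-(1 / 2) : ℝ) :=
          Real.rpow_le_rpow_of_nonpos (by norm_num) h2 (by norm_num)
      _ = (√2)⁻¹ := by rw [Real.rpow_neg (by norm_num), Real.sqrt_eq_rpow]
      _ ≤ (4 / 3)⁻¹ := by
          gcongr
          exact Real.le_sqrt_of_sq_le (by norm_num)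
      _ = 3 / 4 := by norm_num
  · refine (norm_sum_le _ _).trans ?_
    calc _ ≤ ∑ T ∈ Finset.range γ, (1 : ℝ) := by
          refine Finset.sum_le_sum fun T _ => ?_
          generalize (((δ : ZMod γ)⁻¹).val : ℕ) = a
          have : 2 * (Real.pi : ℂ) * Complex.I *
              (((a : ℂ) * ((ℓt : ℂ) - 2 * m * T) ^ 2) / (4 * m * γ)
                - ((ℓ : ℂ) * ((ℓt : ℂ) - 2 * m * T)) / (2 * m * γ)
                + ((δ : ℂ) * (ℓ : ℂ) ^ 2) / (4 * m * γ)) =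
              ((2 * Real.pi * (((a : ℝ) * ((ℓt : ℝ) - 2 * m * T) ^ 2) / (4 * m * γ)
                - ((ℓ : ℝ) * ((ℓt : ℝ) - 2 * m * T)) / (2 * m * γ)
                + ((δ : ℝ) * (ℓ : ℝ) ^ 2) / (4 * m * γ)) : ℝ) : ℂ) * Complex.I := by
            push_cast
            ring
          rw [this, Complex.norm_exp_ofReal_mul_I]
      _ = γ := by simp

theorem norm_Kl_le {m γ : ℕ} (hm : 1 ≤ m) (hγ : 1 ≤ γ) (A B : ℚ) (ℓ ℓt : ℤ) :
    ‖Kl m A B γ ℓ ℓt‖ ≤ 3 / 4 * (γ : ℝ) ^ 2 := by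
  unfold Kl
  refine (norm_sum_le _ _).trans ?_
  calc _ ≤ ∑ j ∈ (Finset.range γ).filter fun j => Nat.gcd j γ = 1, (3 / 4 * γ : ℝ) := by
        refine Finset.sum_le_sum fun j _ => ?_
        rw [norm_mul]
        generalize (((-(j : ℤ) : ZMod γ)⁻¹).val : ℕ) = a
        have : 2 * (Real.pi : ℂ) * Complex.I *
            ((a : ℂ) * (B : ℂ) / γ + ((-(j : ℤ) : ℤ) : ℂ) * (A : ℂ) / γ) =
            ((2 * Real.pi * ((a : ℝ) * (B : ℝ) / γ + ((-(j : ℤ) : ℤ) : ℝ) * (A : ℝ) / γ) : ℝ) : ℂ)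
              * Complex.I := by
          push_cast
          ring
        rw [this, Complex.norm_exp_ofReal_mul_I, one_mul]
        exact norm_psiMult_le hm hγ _ _ _
    _ ≤ γ * (3 / 4 * γ : ℝ) := by
        rw [Finset.sum_const, nsmul_eq_mul]
        gcongr
        exact (Finset.card_filter_le _ _).trans (Finset.card_range γ).le
    _ = _ := by ring

theorem sinh_le_mul_cosh {u : ℝ} (hu : 0 ≤ u) : Real.sinh u ≤ u * Real.cosh u := by
  have hd : ∀ x : ℝ, HasDerivAt (fun x => x * Real.cosh x - Real.sinh x) (x * Real.sinh x) x := by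
    intro x
    refine (((hasDerivAt_id' x).mul (Real.hasDerivAt_cosh x)).sub
      (Real.hasDerivAt_sinh x)).congr_deriv ?_
    ring
  have hmono : Monotone fun x : ℝ => x * Real.cosh x - Real.sinh x := by
    refine monotone_of_hasDerivAt_nonneg hd fun x => ?_
    rcases le_total 0 x with hx | hx
    · exact mul_nonneg hx (Real.sinh_nonneg_iff.2 hx)
    · exact mul_nonneg_of_nonpos_of_nonpos hx (Real.sinh_nonpos_iff.2 hx)
  have := hmono hu
  simp at this
  linarith

theorem abs_inv_sinh_sq_sub_inv_sq_le (u : ℝ) :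
    |1 / Real.sinh u ^ 2 - 1 / u ^ 2| ≤ 1 := by
  wlog hu : 0 ≤ u generalizing u
  · simpa using this (-u) (by linarith)
  rcases hu.eq_or_lt with rfl | hu
  · simp
  have h1 := Real.self_le_sinh_iff.2 hu.le
  have h2 := sinh_le_mul_cosh hu.le
  have hs : 0 < Real.sinh u := hu.trans_le h1
  have h3 : Real.sinh u ^ 2 ≤ u ^ 2 * (1 + Real.sinh u ^ 2) := by
    rw [← Real.cosh_sq', ← mul_pow]
    gcongr
  have h4 : 1 / Real.sinh u ^ 2 ≤ 1 / u ^ 2 := by gcongr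
  have h5 : 1 / u ^ 2 ≤ 1 / Real.sinh u ^ 2 + 1 := by
    rw [div_add_one (by positivity), div_le_div_iff₀ (by positivity) (by positivity)]
    linarith
  rw [abs_le]
  constructor <;> linarith

theorem abs_sin_le_norm_sinh (a c : ℝ) : |Real.sin c| ≤ ‖Complex.sinh (a + c * Complex.I)‖ := by
  have him : (Complex.sinh (a + c * Complex.I)).im = Real.cosh a * Real.sin c := by
    rw [Complex.sinh_add, Complex.sinh_mul_I, Complex.cosh_mul_I]
    simp [← Complex.ofReal_sinh, ← Complex.ofReal_cosh, ← Complex.ofReal_sin,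
      ← Complex.ofReal_cos]
  calc |Real.sin c| ≤ Real.cosh a * |Real.sin c| :=
        le_mul_of_one_le_left (abs_nonneg _) (Real.one_le_cosh a)
    _ = |(Complex.sinh (a + c * Complex.I)).im| := by
        rw [him, abs_mul, abs_of_pos (Real.cosh_pos a)]
    _ ≤ _ := Complex.abs_im_le_norm _

theorem norm_fFun_le {m γ : ℕ} (hm : 1 ≤ m) (hγ : 1 ≤ γ) {g : ℤ}
    (hg : g ∈ Finset.Ioc (-(m : ℤ) * γ) ((m : ℤ) * γ)) (x : ℝ) :
    ‖fFun m γ g x‖ ≤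
      (if g = 0 then π ^ 2 else 0) + π ^ 2 * ((m : ℝ) * γ) ^ 2 * (1 / (g : ℝ) ^ 2) := by
  rw [Finset.mem_Ioc] at hg
  have hm' : (0 : ℝ) < m := by exact_mod_cast hm
  have hγ' : (0 : ℝ) < γ := by exact_mod_cast hγ
  have hpos : 0 < (m : ℤ) * γ := by positivity
  have hiff : g % (2 * (m : ℤ) * γ) = 0 ↔ g = 0 := by
    refine ⟨fun h => Int.eq_zero_of_abs_lt_dvd (Int.dvd_of_emod_eq_zero h) ?_, fun h => by simp [h]⟩
    rw [abs_lt]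
    constructor <;> nlinarith
  unfold fFun
  simp only [hiff]
  split_ifs with h0
  · subst h0
    have : π ^ 2 / Real.sinh (π * x / γ) ^ 2 - (γ : ℝ) ^ 2 / x ^ 2 =
        π ^ 2 * (1 / Real.sinh (π * x / γ) ^ 2 - 1 / (π * x / γ) ^ 2) := by
      have : (γ : ℝ) ^ 2 / x ^ 2 = π ^ 2 * (1 / (π * x / γ) ^ 2) := by
        rcases eq_or_ne x 0 with rfl | hx
        · simp
        · field_simp
      rw [this]
      ring
    rw [Complex.norm_real, this, Real.norm_eq_abs, abs_mul, abs_of_pos (by positivity)]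
    have := abs_inv_sinh_sq_sub_inv_sq_le (π * x / γ)
    simp only [Int.cast_zero, ne_eq, OfNat.ofNat_ne_zero, not_false_eq_true, zero_pow, div_zero,
      mul_zero, add_zero]
    exact mul_le_of_le_one_right (by positivity) this
  · have hg0 : (0 : ℝ) < |(g : ℝ)| := by simpa using h0
    have hgle : |(g : ℝ)| ≤ m * γ := by
      have : |g| ≤ (m : ℤ) * γ := abs_le.2 ⟨by nlinarith, hg.2⟩
      exact_mod_cast this
    set c : ℝ := -(π * g / (2 * m * γ)) with hc
    have hcabs : |c| = π / 2 * (|(g : ℝ)| / (m * γ)) := by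
      rw [hc, abs_neg, abs_div, abs_mul, abs_of_pos Real.pi_pos,
        abs_of_pos (by positivity : (0 : ℝ) < 2 * m * γ)]
      field_simp
    have hratio : |(g : ℝ)| / (m * γ) ≤ 1 := (div_le_one (by positivity)).2 hgle
    have hcle : |c| ≤ π / 2 := by
      rw [hcabs]
      exact mul_le_of_le_one_right (by positivity) hratio
    have hz : (π : ℂ) * x / γ - (π : ℂ) * Complex.I * g / (2 * m * γ) =
        ((π * x / γ : ℝ) : ℂ) + (c : ℂ) * Complex.I := by
      rw [hc]
      push_cast
      ring
    have hlow : |(g : ℝ)| / (m * γ) ≤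
        ‖Complex.sinh (((π * x / γ : ℝ) : ℂ) + (c : ℂ) * Complex.I)‖ := by
      refine le_trans ?_ (abs_sin_le_norm_sinh _ _)
      refine le_of_eq_of_le ?_ (Real.mul_abs_le_abs_sin hcle)
      rw [hcabs]
      field_simp
    rw [hz, norm_div, norm_pow, norm_pow, Complex.norm_real, Real.norm_eq_abs,
      abs_of_pos Real.pi_pos, zero_add]
    calc _ ≤ π ^ 2 / (|(g : ℝ)| / (m * γ)) ^ 2 := by gcongr
      _ = _ := by
        rw [div_pow, sq_abs]
        field_simp

theorem norm_innerInt_le {m γ : ℕ} (hm : 1 ≤ m) (hγ : 1 ≤ γ) {g Δ : ℤ} (hΔ : 0 < Δ)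
    (hg : g ∈ Finset.Ioc (-(m : ℤ) * γ) ((m : ℤ) * γ)) :
    ‖innerInt m γ g Δ‖ ≤
      ((if g = 0 then π ^ 2 else 0) + π ^ 2 * ((m : ℝ) * γ) ^ 2 * (1 / (g : ℝ) ^ 2)) *
        (((γ : ℝ) ^ 6)⁻¹ * besselI (25 / 2) (2 * π * √((Δ : ℝ) / m))) * (2 / √m) := by
  have hm' : (0 : ℝ) < m := by exact_mod_cast hm
  have hγ' : (0 : ℝ) < γ := by exact_mod_cast hγ
  have hΔ' : (0 : ℝ) < Δ := by exact_mod_cast hΔ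
  have hs : 0 < √(m : ℝ) := Real.sqrt_pos.2 hm'
  unfold innerInt
  refine (intervalIntegral.norm_integral_le_of_norm_le_const (C :=
    ((if g = 0 then π ^ 2 else 0) + π ^ 2 * ((m : ℝ) * γ) ^ 2 * (1 / (g : ℝ) ^ 2)) *
        (((γ : ℝ) ^ 6)⁻¹ * besselI (25 / 2) (2 * π * √((Δ : ℝ) / m)))) fun x hx => ?_).trans_eq ?_
  · have hle : -(1 : ℝ) / √m ≤ 1 / √m := by gcongr; norm_num
    rw [Set.uIoc_of_le hle, Set.mem_Ioc] at hx
    have hx2 : m * x ^ 2 ≤ 1 := by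
      have hxa : |x| ≤ 1 / √m := abs_le.2 ⟨by rw [← neg_div]; exact hx.1.le, hx.2⟩
      calc m * x ^ 2 = m * |x| ^ 2 := by rw [sq_abs]
        _ ≤ m * (1 / √m) ^ 2 := by gcongr
        _ = 1 := by rw [div_pow, Real.sq_sqrt hm'.le]; field_simp
    have hmx : 0 ≤ (m : ℝ) * x ^ 2 := by positivity
    have hnn : 0 ≤ 2 * π * √((Δ : ℝ) * (1 - m * x ^ 2)) / (γ * √m) := by positivity
    have hB : besselI (25 / 2) (2 * π * √((Δ : ℝ) * (1 - m * x ^ 2)) / (γ * √m)) ≤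
        ((γ : ℝ) ^ 6)⁻¹ * besselI (25 / 2) (2 * π * √((Δ : ℝ) / m)) := by
      refine besselI_le_of_le_div hγ hnn (by positivity) ?_
      rw [Real.sqrt_div hΔ'.le]
      calc _ ≤ 2 * π * √(Δ : ℝ) / (γ * √m) := by
            gcongr
            exact mul_le_of_le_one_right hΔ'.le (by linarith)
        _ = _ := by field_simp
    have hw : (1 - m * x ^ 2 : ℝ) ^ ((25 : ℝ) / 4) ≤ 1 :=
      Real.rpow_le_one (by linarith) (by linarith) (by norm_num)
    have hw0 : 0 ≤ (1 - m * x ^ 2 : ℝ) ^ ((25 : ℝ) / 4) := Real.rpow_nonneg (by linarith) _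
    have hf := norm_fFun_le hm hγ hg x
    rw [norm_mul, norm_mul, Complex.norm_real, Complex.norm_real, Real.norm_of_nonneg hw0,
      Real.norm_of_nonneg (besselI_nonneg hnn)]
    refine mul_le_mul ?_ hB (besselI_nonneg hnn) ((norm_nonneg _).trans hf)
    exact (mul_le_of_le_one_right (norm_nonneg _) hw).trans hf
  · congr 1
    rw [← sub_div, show (1 : ℝ) - -1 = 2 by norm_num, abs_of_pos (by positivity)]

theorem sum_residue_le {m : ℕ} (s : Finset ℤ) (h : ℤ → ℝ) (hh : ∀ g, 0 ≤ h g) :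
    ∑ ℓt ∈ Finset.Icc (-(m : ℤ) + 1) (m : ℤ),
      ∑ g ∈ s.filter (fun g => g % (2 * (m : ℤ)) = ℓt % (2 * (m : ℤ))), h g ≤ ∑ g ∈ s, h g := by
  simp only [Finset.sum_filter]
  rw [Finset.sum_comm]
  refine Finset.sum_le_sum fun g _ => ?_
  rw [← Finset.sum_filter, Finset.sum_const, nsmul_eq_mul]
  refine mul_le_of_le_one_left (hh g) ?_
  rw [Nat.cast_le_one, Finset.card_le_one]
  intro a ha b hb
  simp only [Finset.mem_filter, Finset.mem_Icc] at ha hb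
  have hd : (2 * (m : ℤ)) ∣ a - b :=
    Int.dvd_of_emod_eq_zero (Int.emod_eq_emod_iff_emod_sub_eq_zero.1 (ha.2.symm.trans hb.2))
  have := Int.eq_zero_of_abs_lt_dvd hd (by rw [abs_lt]; omega)
  omega

theorem sum_one_div_int_sq_le (s : Finset ℤ) : ∑ g ∈ s, 1 / (g : ℝ) ^ 2 ≤ π ^ 2 / 3 := by
  have h : HasSum (fun g : ℤ => 1 / (g : ℝ) ^ 2) (π ^ 2 / 6 + π ^ 2 / 6 - 1 / ((0 : ℤ) : ℝ) ^ 2) :=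
    HasSum.of_nat_of_neg (f := fun g : ℤ => 1 / (g : ℝ) ^ 2)
      (by simpa using hasSum_zeta_two) (by simpa using hasSum_zeta_two)
  refine (sum_le_hasSum s (fun _ _ => by positivity) h).trans_eq ?_
  simp
  ring

theorem norm_tripleTerm_le {m γ : ℕ} (hm : 1 ≤ m) (hγ : 1 ≤ γ) {Δ : ℤ} (hΔ : 0 < Δ) (ℓ : ℤ) :
    ‖tripleTerm m ℓ Δ γ‖ ≤
      3 / 2 * π ^ 2 * (1 + π ^ 2 / 3) * (m : ℝ) ^ ((3 : ℝ) / 2) *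
        besselI (25 / 2) (2 * π * √((Δ : ℝ) / m)) * (1 / (γ : ℝ) ^ 4) := by
  have hm' : (1 : ℝ) ≤ m := by exact_mod_cast hm
  have hγ' : (1 : ℝ) ≤ γ := by exact_mod_cast hγ
  set I := besselI (25 / 2) (2 * π * √((Δ : ℝ) / m)) with hI
  have hI0 : 0 ≤ I := besselI_nonneg (by positivity)
  set s := Finset.Ioc (-(m : ℤ) * γ) ((m : ℤ) * γ) with hs
  set F : ℤ → ℝ := fun g =>
    (if g = 0 then π ^ 2 else 0) + π ^ 2 * ((m : ℝ) * γ) ^ 2 * (1 / (g : ℝ) ^ 2) with hF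
  have hF0 : ∀ g, 0 ≤ F g := fun g => by
    simp only [hF]
    split_ifs <;> positivity
  have hsum : ∑ g ∈ s, F g ≤ π ^ 2 * ((m : ℝ) * γ) ^ 2 * (1 + π ^ 2 / 3) := by
    have h1 : ∑ g ∈ s, (if g = 0 then π ^ 2 else 0) ≤ π ^ 2 := by
      rw [Finset.sum_ite_eq']
      split_ifs
      · exact le_rfl
      · positivity
    have h2 := sum_one_div_int_sq_le s
    have h3 : 1 ≤ ((m : ℝ) * γ) ^ 2 := one_le_pow₀ (one_le_mul_of_one_le_of_one_le hm' hγ')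
    simp only [hF]
    rw [Finset.sum_add_distrib, ← Finset.mul_sum, mul_add, mul_one]
    refine add_le_add (h1.trans (le_mul_of_one_le_right (by positivity) h3)) (by gcongr)
  have hterm : ∀ ℓt : ℤ, ∀ g ∈ s,
      ‖Kl m ((Δ : ℚ) / (4 * m)) (-1 - (g : ℚ) ^ 2 / (4 * m)) γ ℓ ℓt *
        ((γ : ℂ) ^ 2)⁻¹ * innerInt m γ g Δ‖ ≤ 3 / 4 * (F g * (((γ : ℝ) ^ 6)⁻¹ * I) * (2 / √m)) := by
    intro ℓt g hg
    rw [norm_mul, norm_mul, norm_inv, norm_pow, Complex.norm_natCast]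
    refine mul_le_mul ?_ (norm_innerInt_le hm hγ hΔ hg) (norm_nonneg _) (by norm_num)
    rw [← div_eq_mul_inv, div_le_iff₀ (by positivity)]
    exact norm_Kl_le hm hγ _ _ _ _
  unfold tripleTerm
  calc _ ≤ ∑ ℓt ∈ Finset.Icc (-(m : ℤ) + 1) (m : ℤ),
        ∑ g ∈ s.filter (fun g => g % (2 * (m : ℤ)) = ℓt % (2 * (m : ℤ))),
          3 / 4 * (F g * (((γ : ℝ) ^ 6)⁻¹ * I) * (2 / √m)) := by
        refine (norm_sum_le _ _).trans (Finset.sum_le_sum fun ℓt _ => ?_)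
        exact (norm_sum_le _ _).trans
          (Finset.sum_le_sum fun g hg => hterm ℓt g (Finset.mem_filter.1 hg).1)
    _ ≤ ∑ g ∈ s, 3 / 4 * (F g * (((γ : ℝ) ^ 6)⁻¹ * I) * (2 / √m)) :=
        sum_residue_le s _ fun g => by
          have := hF0 g
          positivity
    _ = (∑ g ∈ s, F g) * (3 / 2 * (((γ : ℝ) ^ 6)⁻¹ * I) * (1 / √m)) := by
        rw [Finset.sum_mul]
        exact Finset.sum_congr rfl fun g _ => by ring
    _ ≤ (π ^ 2 * ((m : ℝ) * γ) ^ 2 * (1 + π ^ 2 / 3)) *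
          (3 / 2 * (((γ : ℝ) ^ 6)⁻¹ * I) * (1 / √m)) := by gcongr
    _ = _ := by
        have hm0 : (0 : ℝ) < m := by linarith
        have hpow : (m : ℝ) ^ ((3 : ℝ) / 2) = m ^ 2 / √m := by
          rw [Real.sqrt_eq_rpow, ← Real.rpow_natCast (m : ℝ) 2, ← Real.rpow_sub hm0]
          norm_num
        rw [hpow]
        field_simp

theorem dcoef_nonneg (n : ℤ) : 0 ≤ dcoef n := by
  unfold dcoef
  split_ifs
  · exact Finset.sum_nonneg fun _ _ => Finset.prod_nonneg fun _ _ => by positivity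
  · exact le_rfl

theorem zeta_four_constant_le :
    3 / 4 * (1 + π ^ 2 / 3) * (π ^ 4 / 90) ≤ (1 + 2 / 21) * (π ^ 2 / 3 + 1 / 3) := by
  have h1 : π ^ 2 ≤ 9.87 := by nlinarith [Real.pi_lt_d4, Real.pi_pos]
  have h2 : 9.8 ≤ π ^ 2 := by nlinarith [Real.pi_gt_d4]
  have h3 : π ^ 4 ≤ 97.5 := by nlinarith
  calc 3 / 4 * (1 + π ^ 2 / 3) * (π ^ 4 / 90)
      ≤ 3 / 4 * (1 + 9.87 / 3) * (97.5 / 90) := by gcongr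
    _ ≤ (1 + 2 / 21) * (9.8 / 3 + 1 / 3) := by norm_num
    _ ≤ _ := by gcongr

theorem stmt6 (m : ℕ) (hm : 1 ≤ m) (n ℓ : ℤ)
    (hΔ : 0 < 4 * (m : ℤ) * n - ℓ ^ 2) :
    Summable (fun γ : ℕ =>
      ‖(((2 * Real.pi)⁻¹ * (dcoef m : ℝ) *
          ((4 * (m : ℝ)) / ((4 * (m : ℤ) * n - ℓ ^ 2 : ℤ) : ℝ)) ^ ((25 : ℝ) / 4) : ℝ) : ℂ) *
        tripleTerm m ℓ (4 * (m : ℤ) * n - ℓ ^ 2) (γ + 1)‖) ∧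
    ‖∑' γ : ℕ,
        (((2 * Real.pi)⁻¹ * (dcoef m : ℝ) *
          ((4 * (m : ℝ)) / ((4 * (m : ℤ) * n - ℓ ^ 2 : ℤ) : ℝ)) ^ ((25 : ℝ) / 4) : ℝ) : ℂ) *
        tripleTerm m ℓ (4 * (m : ℤ) * n - ℓ ^ 2) (γ + 1)‖ ≤
      (1 + 2 / 21) * (dcoef m : ℝ) *
        ((4 * (m : ℝ)) / ((4 * (m : ℤ) * n - ℓ ^ 2 : ℤ) : ℝ)) ^ ((25 : ℝ) / 4) *
        (m : ℝ) ^ ((3 : ℝ) / 2) * Real.pi * (Real.pi ^ 2 / 3 + 1 / 3) *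
        besselI (25 / 2)
          (2 * Real.pi * Real.sqrt (((4 * (m : ℤ) * n - ℓ ^ 2 : ℤ) : ℝ) / m)) := by
  set Δ : ℤ := 4 * (m : ℤ) * n - ℓ ^ 2 with hΔdef
  have hΔ' : (0 : ℝ) < Δ := by exact_mod_cast hΔ
  set I := besselI (25 / 2) (2 * π * √((Δ : ℝ) / m)) with hI
  have hI0 : 0 ≤ I := besselI_nonneg (by positivity)
  have hd : (0 : ℝ) ≤ dcoef m := by exact_mod_cast dcoef_nonneg m
  set P : ℝ := ((4 * (m : ℝ)) / (Δ : ℝ)) ^ ((25 : ℝ) / 4) with hP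
  have hP0 : 0 ≤ P := by positivity
  set M : ℝ := (m : ℝ) ^ ((3 : ℝ) / 2) with hM
  have hM0 : 0 ≤ M := by positivity
  set K : ℝ := 3 / 4 * (1 + π ^ 2 / 3) * (dcoef m * P * M * π * I) with hK
  have hbound : ∀ γ : ℕ, ‖(((2 * π)⁻¹ * (dcoef m : ℝ) * P : ℝ) : ℂ) * tripleTerm m ℓ Δ (γ + 1)‖ ≤
      K * (1 / ((γ + 1 : ℕ) : ℝ) ^ 4) := by
    intro γ
    rw [norm_mul, Complex.norm_real, Real.norm_of_nonneg (by positivity)]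
    refine (mul_le_mul_of_nonneg_left (norm_tripleTerm_le hm (Nat.le_add_left 1 γ) hΔ ℓ)
      (by positivity)).trans_eq ?_
    rw [hK, ← hI, ← hM]
    field_simp
    ring
  have hzeta : HasSum (fun γ : ℕ => K * (1 / ((γ + 1 : ℕ) : ℝ) ^ 4)) (K * (π ^ 4 / 90)) := by
    refine HasSum.mul_left K ?_
    rw [hasSum_nat_add_iff (f := fun γ : ℕ => 1 / (γ : ℝ) ^ 4) 1]
    simpa using hasSum_zeta_four
  refine ⟨Summable.of_nonneg_of_le (fun _ => norm_nonneg _) hbound hzeta.summable, ?_⟩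
  calc _ ≤ K * (π ^ 4 / 90) := tsum_of_norm_bounded hzeta hbound
    _ = (3 / 4 * (1 + π ^ 2 / 3) * (π ^ 4 / 90)) * (dcoef m * P * M * π * I) := by
        rw [hK]
        ring
    _ ≤ ((1 + 2 / 21) * (π ^ 2 / 3 + 1 / 3)) * (dcoef m * P * M * π * I) := by
        gcongr ?_ * _
        exact zeta_four_constant_le
    _ = _ := by ring
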